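/- arXiv:1905.04282 — 4 statements merged into one kernel-verified Lean document; each statement's English description precedes it below -/
import Mathlib

section
/- Let 𝔉 be a number field and 𝔉_ℂ = 𝔉 ⊗_ℚ ℂ. Let H_B and H_dR be 2-dimensional ℚ-vector spaces, F_∞ : H_B → H_B a ℚ-linear involution whose (+1)- and (−1)-eigenspaces H_B^+ and H_B^− are each 1-dimensional, F⁰ ⊆ H_dR a 1-dimensional subspace, and I_M : H_B ⊗_ℚ ℂ → H_dR ⊗_ℚ ℂ a ℂ-linear isomorphism. For each sign ε ∈ {+,−} let α^ε : H_B^ε ⊗_ℚ ℂ → (H_dR/F⁰) ⊗_ℚ ℂ be the composite of the inclusion H_B^ε ⊗ ℂ → H_B ⊗ ℂ, the map I_M, and the map induced by the quotient H_dR → H_dR/F⁰; assume α^+ and α^− are isomorphisms, fix ℚ-bases γ^± of H_B^± and ω̄ of H_dR/F⁰, and define c^± ∈ ℂ^× by α^±(γ^± ⊗ 1) = ω̄ ⊗ c^±. Let W_B and W_dR be d-dimensional 𝔉-vector spaces, G_∞ : W_B → W_B an 𝔉-linear involution with μ = dim_𝔉 (+1-eigenspace of G_∞) and ν = dim_𝔉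 (−1-eigenspace of G_∞), and let I_N : W_B ⊗_ℚ ℂ → W_dR ⊗_ℚ ℂ be an isomorphism of 𝔉_ℂ-modules; fix 𝔉-bases of W_B and W_dR and let det(I_N) ∈ 𝔉_ℂ^× be the determinant of I_N with respect to them. Consider on the 𝔉-vector space H_B ⊗_ℚ W_B the involution F_∞ ⊗ G_∞, let (H_B ⊗ W_B)^+ be its (+1)-eigenspace, and let α : (H_B ⊗_ℚ W_B)^+ ⊗_ℚ ℂ → ((H_dR ⊗_ℚ W_dR)/(F⁰ ⊗_ℚ W_dR)) ⊗_ℚ ℂ be the 𝔉_ℂ-linear map obtained by composing the inclusion, the map I_M ⊗ I_N, and the quotient map. Then (H_B ⊗ W_B)^+ has 𝔉-dimension d, α is an isomorphism of 𝔉_ℂ-modules, and for any choice of 𝔉-bases of (H_B ⊗ W_B)^+ and of (H_dR ⊗ W_dR)/(F⁰ ⊗ W_dR) there exists λ ∈ 𝔉^× such that det(α) = λ · (1 ⊗ (c^+)^μ (c^−)^ν) · det(I_N) in 𝔉_ℂ. -/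
open TensorProduct Module

noncomputable section

section PeriodSetup

/-! ### The motive `M`: Betti and de Rham data over `ℚ` -/

variable {HB HdR : Type} [AddCommGroup HB] [Module ℚ HB] [AddCommGroup HdR] [Module ℚ HdR]

/-- The period map `α` associated to a subspace `H ⊆ H_B` (e.g. an eigenspace of `F_∞`):
the composite of the inclusion `H ⊗ ℂ → H_B ⊗ ℂ`, the comparison isomorphism `I_M`, and the
map induced by the quotient `H_dR → H_dR/F⁰`. -/
def periodMap (F0 : Submodule ℚ HdR) (IM : (ℂ ⊗[ℚ] HB) ≃ₗ[ℂ] (ℂ ⊗[ℚ] HdR))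
    (H : Submodule ℚ HB) : (ℂ ⊗[ℚ] ↥H) →ₗ[ℂ] (ℂ ⊗[ℚ] (HdR ⧸ F0)) :=
  (LinearMap.baseChange ℂ F0.mkQ) ∘ₗ IM.toLinearMap ∘ₗ (LinearMap.baseChange ℂ H.subtype)

/-! ### The motive `N`: data over the number field `𝔉`, and the coefficient ring `A ≅ 𝔉 ⊗ ℂ` -/

variable (𝔉 : Type) [Field 𝔉] [NumberField 𝔉]
variable {WB WdR : Type}
  [AddCommGroup WB] [Module ℚ WB] [Module 𝔉 WB] [IsScalarTower ℚ 𝔉 WB]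
  [AddCommGroup WdR] [Module ℚ WdR] [Module 𝔉 WdR] [IsScalarTower ℚ 𝔉 WdR]
variable (A : Type) [CommRing A] [Algebra ℚ A] [Algebra 𝔉 A] [Algebra ℂ A]
  [IsScalarTower ℚ 𝔉 A] [IsScalarTower ℚ ℂ A] [SMulCommClass 𝔉 ℂ A]

/-- The `𝔉`-linear involution `F_∞ ⊗ G_∞` on `W_B ⊗_ℚ H_B`. -/
def tensorInvolution (Finf : HB →ₗ[ℚ] HB) (Ginf : WB →ₗ[𝔉] WB) :
    (WB ⊗[ℚ] HB) →ₗ[𝔉] (WB ⊗[ℚ] HB) :=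
  AlgebraTensorModule.map Ginf Finf

/-- The `𝔉`-submodule `F⁰ ⊗ W_dR` of `W_dR ⊗_ℚ H_dR`. -/
def tensorFil (F0 : Submodule ℚ HdR) : Submodule 𝔉 (WdR ⊗[ℚ] HdR) :=
  LinearMap.range (AlgebraTensorModule.map (LinearMap.id : WdR →ₗ[𝔉] WdR) F0.subtype)

/-- The comparison isomorphism `I_M ⊗ I_N` on the base change to `A = 𝔉_ℂ` of
`W_B ⊗_ℚ H_B`, obtained from `I_N` and `I_M` via the canonical associativity and
base-change isomorphisms. -/
def tensorComparison (IM : (ℂ ⊗[ℚ] HB) ≃ₗ[ℂ] (ℂ ⊗[ℚ] HdR))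
    (IN : (A ⊗[𝔉] WB) ≃ₗ[A] (A ⊗[𝔉] WdR)) :
    (A ⊗[𝔉] (WB ⊗[ℚ] HB)) →ₗ[A] (A ⊗[𝔉] (WdR ⊗[ℚ] HdR)) :=
  (AlgebraTensorModule.assoc ℚ 𝔉 A A WdR HdR).toLinearMap ∘ₗ
  (AlgebraTensorModule.cancelBaseChange ℚ ℂ A (A ⊗[𝔉] WdR) HdR).toLinearMap ∘ₗ
  (AlgebraTensorModule.map (LinearMap.id : (A ⊗[𝔉] WdR) →ₗ[A] (A ⊗[𝔉] WdR)) IM.toLinearMap) ∘ₗ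
  (AlgebraTensorModule.cancelBaseChange ℚ ℂ A (A ⊗[𝔉] WdR) HB).symm.toLinearMap ∘ₗ
  (AlgebraTensorModule.map IN.toLinearMap (LinearMap.id : HB →ₗ[ℚ] HB)) ∘ₗ
  (AlgebraTensorModule.assoc ℚ 𝔉 A A WB HB).symm.toLinearMap

/-- The period map `α` of the tensor product: the composite of the inclusion of the
`(+1)`-eigenspace of `F_∞ ⊗ G_∞` (base changed to `A = 𝔉_ℂ`), the comparison map
`I_M ⊗ I_N`, and the quotient by `F⁰ ⊗ W_dR`. -/
def tensorPeriodMap (F0 : Submodule ℚ HdR) (IM : (ℂ ⊗[ℚ] HB) ≃ₗ[ℂ] (ℂ ⊗[ℚ] HdR))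
    (IN : (A ⊗[𝔉] WB) ≃ₗ[A] (A ⊗[𝔉] WdR)) (Finf : HB →ₗ[ℚ] HB) (Ginf : WB →ₗ[𝔉] WB) :
    (A ⊗[𝔉] ↥(Module.End.eigenspace (tensorInvolution 𝔉 Finf Ginf) 1)) →ₗ[A]
      (A ⊗[𝔉] ((WdR ⊗[ℚ] HdR) ⧸ tensorFil 𝔉 F0)) :=
  (LinearMap.baseChange A (tensorFil 𝔉 F0).mkQ) ∘ₗ
  (tensorComparison 𝔉 A IM IN) ∘ₗ
  (LinearMap.baseChange A (Module.End.eigenspace (tensorInvolution 𝔉 Finf Ginf) 1).subtype)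

/-! ### Eigenprojections of an involution -/

section Involution

variable {K V : Type*} [Field K] [AddCommGroup V] [Module K V]

/-- The projection `(1 + ε G) / 2`, which for an involution `G` and a sign `ε` is the projection
onto the `ε`-eigenspace of `G` along the `(-ε)`-eigenspace. -/
def signProj (G : V →ₗ[K] V) (ε : K) : V →ₗ[K] V :=
  (2⁻¹ : K) • (LinearMap.id + ε • G)

lemma signProj_apply (G : V →ₗ[K] V) (ε : K) (v : V) :
    signProj G ε v = (2⁻¹ : K) • (v + ε • G v) := rfl

lemma signProj_mem {G : V →ₗ[K] V} (hG : G ∘ₗ G = LinearMap.id) {ε : K} (hε : ε * ε = 1) (v : V) :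
    signProj G ε v ∈ End.eigenspace G ε := by
  have h : G (G v) = v := LinearMap.congr_fun hG v
  rw [End.mem_eigenspace_iff, signProj_apply, map_smul, map_add, map_smul, h, smul_comm ε,
    smul_add ε, smul_smul, hε, one_smul, add_comm]

lemma signProj_of_mem_neg {G : V →ₗ[K] V} {ε : K} (hε : ε * ε = 1) {v : V}
    (hv : v ∈ End.eigenspace G (-ε)) : signProj G ε v = 0 := by
  rw [End.mem_eigenspace_iff] at hv
  rw [signProj_apply, hv, smul_smul, mul_neg, hε, neg_smul, one_smul, add_neg_cancel, smul_zero]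

/-- The coordinate of the eigenprojection of an involution with one-dimensional eigenspace. -/
lemma exists_coord_signProj {G : V →ₗ[K] V} (hG : G ∘ₗ G = LinearMap.id) {ε : K}
    (hε : ε * ε = 1) (B : Basis (Fin 1) K ↥(End.eigenspace G ε)) :
    ∃ φ : V →ₗ[K] K, ∀ v, φ v • (B 0 : V) = signProj G ε v := by
  refine ⟨B.coord 0 ∘ₗ (signProj G ε).codRestrict _ (signProj_mem hG hε), fun v => ?_⟩
  have h := congrArg Subtype.val
    (B.sum_repr ((signProj G ε).codRestrict _ (signProj_mem hG hε) v))
  simpa using h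

lemma signProj_neg_one_of_mem {G : V →ₗ[K] V} {v : V}
    (hv : v ∈ End.eigenspace G 1) : signProj G (-1) v = 0 :=
  signProj_of_mem_neg (by ring) (by rwa [neg_neg])

variable [CharZero K]

lemma signProj_of_mem {G : V →ₗ[K] V} {ε : K} (hε : ε * ε = 1) {v : V}
    (hv : v ∈ End.eigenspace G ε) : signProj G ε v = v := by
  rw [End.mem_eigenspace_iff] at hv
  rw [signProj_apply, hv, smul_smul, hε, one_smul, ← two_smul K v, smul_smul,
    inv_mul_cancel₀ two_ne_zero, one_smul]

lemma signProj_one_add_signProj_neg_one (G : V →ₗ[K] V) (v : V) :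
    signProj G 1 v + signProj G (-1) v = v := by
  rw [signProj_apply, signProj_apply, ← smul_add, one_smul, neg_smul, one_smul,
    add_add_add_comm, add_neg_cancel, add_zero, ← two_smul K v, smul_smul,
    inv_mul_cancel₀ two_ne_zero, one_smul]

lemma signProj_one_sub_signProj_neg_one (G : V →ₗ[K] V) (v : V) :
    signProj G 1 v - signProj G (-1) v = G v := by
  rw [signProj_apply, signProj_apply, ← smul_sub, one_smul, neg_smul, one_smul,
    add_sub_add_left_eq_sub, sub_neg_eq_add, ← two_smul K (G v), smul_smul,
    inv_mul_cancel₀ two_ne_zero, one_smul]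

lemma isCompl_eigenspace_of_involution {G : V →ₗ[K] V} (hG : G ∘ₗ G = LinearMap.id) :
    IsCompl (End.eigenspace G 1) (End.eigenspace G (-1)) := by
  refine ⟨?_, ?_⟩
  · rw [Submodule.disjoint_def]
    intro v h1 h2
    rw [← signProj_of_mem (one_mul 1) h1, signProj_of_mem_neg (one_mul 1) h2]
  · rw [codisjoint_iff, eq_top_iff]
    intro v _
    rw [← signProj_one_add_signProj_neg_one G v]
    exact Submodule.add_mem_sup (signProj_mem hG (one_mul 1) v)
      (signProj_mem hG (by ring) v)

/-- The determinant of the map acting by the scalars `a` and `b` on the base changes of the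
two eigenspaces of an involution. -/
lemma det_smul_signProj_baseChange [FiniteDimensional K V] {G : V →ₗ[K] V}
    (hG : G ∘ₗ G = LinearMap.id) {S : Type*} [CommRing S] [Algebra K S] (a b : S) :
    LinearMap.det (a • (signProj G 1).baseChange S + b • (signProj G (-1)).baseChange S) =
      a ^ finrank K ↥(End.eigenspace G 1) * b ^ finrank K ↥(End.eigenspace G (-1)) := by
  classical
  let B := ((finBasis K ↥(End.eigenspace G 1)).prod (finBasis K ↥(End.eigenspace G (-1)))).map
    (Submodule.prodEquivOfIsCompl _ _ (isCompl_eigenspace_of_involution hG))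
  have key : LinearMap.toMatrix (B.baseChange S) (B.baseChange S)
      (a • (signProj G 1).baseChange S + b • (signProj G (-1)).baseChange S) =
      Matrix.diagonal (Sum.elim (fun _ => a) (fun _ => b)) := by
    have hB : ∀ j, (a • (signProj G 1).baseChange S + b • (signProj G (-1)).baseChange S)
        (B.baseChange S j) = (Sum.elim (fun _ => a) (fun _ => b) j : S) • B.baseChange S j := by
      rintro (j | j)
      · have hj : B (Sum.inl j) ∈ End.eigenspace G 1 := by simp [B]
        simp [signProj_of_mem (one_mul 1) hj, signProj_neg_one_of_mem hj]
      · have hj : B (Sum.inr j) ∈ End.eigenspace G (-1) := by simp [B]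
        simp [signProj_of_mem (by ring) hj, signProj_of_mem_neg (one_mul 1) hj]
    ext i j
    rw [LinearMap.toMatrix_apply, hB, map_smul, Basis.repr_self, Finsupp.smul_apply,
      Finsupp.single_apply, Matrix.diagonal_apply]
    by_cases h : i = j
    · simp [h]
    · simp [h, Ne.symm h]
  rw [← LinearMap.det_toMatrix (B.baseChange S), key, Matrix.det_diagonal, Fintype.prod_sum_type]
  simp

end Involution

/-! ### Trivializing the source and the target of the tensor period map -/

lemma exists_equiv_eigenspace_tensorInvolution
    {Finf : HB →ₗ[ℚ] HB} (hFinv : Finf ∘ₗ Finf = LinearMap.id)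
    (Bp : Basis (Fin 1) ℚ ↥(End.eigenspace Finf 1))
    (Bm : Basis (Fin 1) ℚ ↥(End.eigenspace Finf (-1)))
    {Ginf : WB →ₗ[𝔉] WB} (hGinv : Ginf ∘ₗ Ginf = LinearMap.id) :
    ∃ e : WB ≃ₗ[𝔉] ↥(End.eigenspace (tensorInvolution 𝔉 Finf Ginf) 1),
      ∀ w, (e w : WB ⊗[ℚ] HB) =
        signProj Ginf 1 w ⊗ₜ (Bp 0 : HB) + signProj Ginf (-1) w ⊗ₜ (Bm 0 : HB) := by
  obtain ⟨φp, hφp⟩ := exists_coord_signProj hFinv (one_mul 1) Bp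
  obtain ⟨φm, hφm⟩ := exists_coord_signProj hFinv (by ring) Bm
  have hp0 : (Bp 0 : HB) ≠ 0 := by simpa using Bp.ne_zero 0
  have hm0 : (Bm 0 : HB) ≠ 0 := by simpa using Bm.ne_zero 0
  have hpp : φp (Bp 0) = 1 := smul_left_injective ℚ hp0 <| by
    simp only [hφp, signProj_of_mem (one_mul 1) (Bp 0).2, one_smul]
  have hpm : φp (Bm 0) = 0 := smul_left_injective ℚ hp0 <| by
    simp only [hφp, signProj_of_mem_neg (one_mul 1) (Bm 0).2, zero_smul]
  have hmm : φm (Bm 0) = 1 := smul_left_injective ℚ hm0 <| by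
    simp only [hφm, signProj_of_mem (by ring) (Bm 0).2, one_smul]
  have hmp : φm (Bp 0) = 0 := smul_left_injective ℚ hm0 <| by
    simp only [hφm, signProj_neg_one_of_mem (Bp 0).2, zero_smul]
  let i (h : HB) : WB →ₗ[𝔉] WB ⊗[ℚ] HB := (AlgebraTensorModule.mk ℚ 𝔉 WB HB).flip h
  let r (φ : HB →ₗ[ℚ] ℚ) : WB ⊗[ℚ] HB →ₗ[𝔉] WB :=
    (AlgebraTensorModule.rid ℚ 𝔉 WB).toLinearMap ∘ₗ AlgebraTensorModule.map LinearMap.id φ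
  let E : WB →ₗ[𝔉] WB ⊗[ℚ] HB :=
    i (Bp 0) ∘ₗ signProj Ginf 1 + i (Bm 0) ∘ₗ signProj Ginf (-1)
  let f : WB ⊗[ℚ] HB →ₗ[𝔉] WB := signProj Ginf 1 ∘ₗ r φp + signProj Ginf (-1) ∘ₗ r φm
  have hE (w : WB) : E w =
      signProj Ginf 1 w ⊗ₜ (Bp 0 : HB) + signProj Ginf (-1) w ⊗ₜ (Bm 0 : HB) := rfl
  have hr (φ : HB →ₗ[ℚ] ℚ) (w : WB) (h : HB) : r φ (w ⊗ₜ h) = φ h • w := by simp [r]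
  have hfE : f ∘ₗ E = LinearMap.id := by
    ext w
    have h1 := signProj_mem hGinv (one_mul 1) w
    have h2 := signProj_mem hGinv (ε := -1) (by ring) w
    simp [f, hE, hr, hpp, hpm, hmm, hmp, signProj_of_mem (one_mul 1) h1,
      signProj_of_mem (by ring) h2, signProj_one_add_signProj_neg_one]
  have hEf : E ∘ₗ f = signProj (tensorInvolution 𝔉 Finf Ginf) 1 := by
    refine AlgebraTensorModule.ext fun w h => ?_
    have h1 := signProj_mem hGinv (one_mul 1) w
    have h2 := signProj_mem hGinv (ε := -1) (by ring) w
    have hL : E (f (w ⊗ₜ h)) = signProj Ginf 1 w ⊗ₜ signProj Finf 1 h +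
        signProj Ginf (-1) w ⊗ₜ signProj Finf (-1) h := by
      simp only [f, LinearMap.add_apply, LinearMap.comp_apply, hr, ← hφp, ← hφm, tmul_smul, hE,
        map_add, LinearMap.map_smul_of_tower, signProj_of_mem (one_mul 1) h1,
        signProj_of_mem (by ring) h2, signProj_neg_one_of_mem h1,
        signProj_of_mem_neg (one_mul 1) h2, smul_zero, add_zero, zero_add, smul_tmul']
    have hR : w ⊗ₜ[ℚ] h + Ginf w ⊗ₜ[ℚ] Finf h = (2 : 𝔉) • (signProj Ginf 1 w ⊗ₜ signProj Finf 1 h +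
        signProj Ginf (-1) w ⊗ₜ signProj Finf (-1) h) := by
      conv_lhs =>
        rw [← signProj_one_sub_signProj_neg_one Ginf, ← signProj_one_sub_signProj_neg_one Finf]
        lhs
        rw [← signProj_one_add_signProj_neg_one Ginf w, ← signProj_one_add_signProj_neg_one Finf h]
      simp only [add_tmul, tmul_add, sub_tmul, tmul_sub, two_smul]
      abel
    have hT : tensorInvolution 𝔉 Finf Ginf (w ⊗ₜ h) = Ginf w ⊗ₜ Finf h := rfl
    rw [LinearMap.comp_apply, hL, signProj_apply (tensorInvolution 𝔉 Finf Ginf), one_smul, hT, hR, smul_smul, inv_mul_cancel₀ two_ne_zero, one_smul]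
  have hEmem (w : WB) : E w ∈ End.eigenspace (tensorInvolution 𝔉 Finf Ginf) 1 := by
    have h1 := End.mem_eigenspace_iff.1 (signProj_mem hGinv (one_mul 1) w)
    have h2 := End.mem_eigenspace_iff.1 (signProj_mem hGinv (ε := -1) (by ring) w)
    have h3 := End.mem_eigenspace_iff.1 (Bp 0).2
    have h4 := End.mem_eigenspace_iff.1 (Bm 0).2
    rw [End.mem_eigenspace_iff, hE]
    simp [tensorInvolution, h1, h2, h3, h4, neg_tmul, tmul_neg]
  refine ⟨LinearEquiv.ofLinearMap (E.codRestrict _ hEmem) (f ∘ₗ Submodule.subtype _) ?_ ?_, hE⟩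
  · ext x
    exact (LinearMap.congr_fun hEf x).trans (signProj_of_mem (one_mul 1) x.2)
  · exact hfE

lemma exists_equiv_quotient_tensorFil (F0 : Submodule ℚ HdR)
    (B : Basis (Fin 1) ℚ (HdR ⧸ F0)) :
    ∃ q : ((WdR ⊗[ℚ] HdR) ⧸ tensorFil 𝔉 F0) ≃ₗ[𝔉] WdR,
      ∀ w h, q ((tensorFil 𝔉 F0).mkQ (w ⊗ₜ h)) = B.coord 0 (F0.mkQ h) • w := by
  let κ : HdR →ₗ[ℚ] ℚ := B.coord 0 ∘ₗ F0.mkQ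
  have hker (x : HdR ⧸ F0) (hx : B.coord 0 x = 0) : x = 0 :=
    B.ext_elem fun i => by simpa [Subsingleton.elim i 0] using hx
  have hex : Function.Exact F0.subtype κ := by
    intro h
    refine ⟨fun h0 => ?_, ?_⟩
    · exact ⟨⟨h, (Submodule.Quotient.mk_eq_zero F0).1 (hker _ h0)⟩, rfl⟩
    · rintro ⟨y, rfl⟩
      have hy : F0.mkQ (y : HdR) = 0 := (Submodule.Quotient.mk_eq_zero F0).2 y.2
      change B.coord 0 (F0.mkQ (y : HdR)) = 0
      rw [hy, map_zero]
  have hsurj : Function.Surjective κ := fun t => by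
    obtain ⟨h, hh⟩ := F0.mkQ_surjective (t • B 0)
    exact ⟨h, by simp [κ, hh]⟩
  let ψ : WdR ⊗[ℚ] HdR →ₗ[𝔉] WdR :=
    (AlgebraTensorModule.rid ℚ 𝔉 WdR).toLinearMap ∘ₗ AlgebraTensorModule.map LinearMap.id κ
  have hψ (w : WdR) (h : HdR) : ψ (w ⊗ₜ h) = κ h • w := by simp [ψ]
  have hψs : Function.Surjective ψ := fun w => by
    obtain ⟨h, hh⟩ := hsurj 1
    exact ⟨w ⊗ₜ h, by rw [hψ, hh, one_smul]⟩
  have hψk : tensorFil 𝔉 F0 = LinearMap.ker ψ := by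
    ext x
    have hx := lTensor_exact WdR hex hsurj x
    rw [LinearMap.mem_ker]
    refine Iff.trans ?_ (hx.symm.trans ?_)
    · rfl
    · exact ((AlgebraTensorModule.rid ℚ 𝔉 WdR).map_eq_zero_iff).symm
  exact ⟨Submodule.quotEquivOfEq _ _ hψk ≪≫ₗ ψ.quotKerEquivOfSurjective hψs,
    fun w h => hψ w h⟩

/-- The comparison isomorphism followed by evaluation of a linear form on `H_dR`. -/
lemma baseChange_tensorComparison_tmul (IM : (ℂ ⊗[ℚ] HB) ≃ₗ[ℂ] (ℂ ⊗[ℚ] HdR))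
    (IN : (A ⊗[𝔉] WB) ≃ₗ[A] (A ⊗[𝔉] WdR)) (κ : HdR →ₗ[ℚ] ℚ)
    (ψ : WdR ⊗[ℚ] HdR →ₗ[𝔉] WdR) (hψ : ∀ w h, ψ (w ⊗ₜ h) = κ h • w) (w : WB) (h : HB) :
    ψ.baseChange A (tensorComparison 𝔉 A IM IN (1 ⊗ₜ (w ⊗ₜ h))) =
      algebraMap ℂ A (AlgebraTensorModule.rid ℚ ℂ ℂ (κ.baseChange ℂ (IM (1 ⊗ₜ h)))) •
        IN (1 ⊗ₜ w) := by
  have key (y : A ⊗[𝔉] WdR) (z : ℂ ⊗[ℚ] HdR) :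
      ψ.baseChange A (AlgebraTensorModule.assoc ℚ 𝔉 A A WdR HdR
        (AlgebraTensorModule.cancelBaseChange ℚ ℂ A (A ⊗[𝔉] WdR) HdR (y ⊗ₜ z))) =
      algebraMap ℂ A (AlgebraTensorModule.rid ℚ ℂ ℂ (κ.baseChange ℂ z)) • y := by
    induction z with
    | zero => simp
    | add z₁ z₂ h₁ h₂ => simp only [tmul_add, map_add, h₁, h₂, add_smul]
    | tmul c h =>
      induction y with
      | zero => simp
      | add y₁ y₂ h₁ h₂ => simp only [add_tmul, map_add, h₁, h₂, smul_add]
      | tmul a w =>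
        simp [smul_tmul', tmul_smul, hψ, Algebra.smul_def, mul_assoc,
          IsScalarTower.algebraMap_apply ℚ ℂ A]
  rw [← key]
  simp [tensorComparison]

lemma rid_baseChange_coord_mkQ (F0 : Submodule ℚ HdR) (IM : (ℂ ⊗[ℚ] HB) ≃ₗ[ℂ] (ℂ ⊗[ℚ] HdR))
    (H : Submodule ℚ HB) (B : Basis (Fin 1) ℚ (HdR ⧸ F0)) (x : H) (c : ℂ)
    (hc : periodMap F0 IM H (1 ⊗ₜ x) = c • (1 ⊗ₜ B 0)) :
    AlgebraTensorModule.rid ℚ ℂ ℂ ((B.coord 0 ∘ₗ F0.mkQ).baseChange ℂ (IM (1 ⊗ₜ (x : HB)))) = c := by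
  have h := congrArg (fun z => AlgebraTensorModule.rid ℚ ℂ ℂ ((B.coord 0).baseChange ℂ z)) hc
  simp only [periodMap, LinearMap.comp_apply, LinearMap.baseChange_tmul] at h
  rw [LinearMap.baseChange_comp]
  simpa using h

/-- A period of a nondegenerate one-dimensional period map is nonzero. -/
lemma period_ne_zero {F0 : Submodule ℚ HdR} {IM : (ℂ ⊗[ℚ] HB) ≃ₗ[ℂ] (ℂ ⊗[ℚ] HdR)}
    {H : Submodule ℚ HB} (hα : Function.Bijective (periodMap F0 IM H))
    (B : Basis (Fin 1) ℚ H) {y : ℂ ⊗[ℚ] (HdR ⧸ F0)} {c : ℂ}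
    (hc : periodMap F0 IM H (1 ⊗ₜ B 0) = c • y) : c ≠ 0 := by
  rintro rfl
  rw [zero_smul, ← map_zero (periodMap F0 IM H)] at hc
  exact (B.baseChange ℂ).ne_zero 0 (by simpa using hα.1 hc)

/-- The determinant of a base-changed linear equivalence is a unit of the base field. -/
lemma exists_unit_det_toMatrix_baseChange {K V V' S ι : Type*} [Field K] [AddCommGroup V]
    [Module K V] [AddCommGroup V'] [Module K V'] [CommRing S] [Algebra K S] [Fintype ι]
    [DecidableEq ι] (b : Basis ι K V) (b' : Basis ι K V') (e : V ≃ₗ[K] V') :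
    ∃ u : Kˣ, (LinearMap.toMatrix (b.baseChange S) (b'.baseChange S)
      (e.toLinearMap.baseChange S)).det = algebraMap K S u := by
  refine ⟨(LinearEquiv.isUnit_det e b b').unit, ?_⟩
  have h : LinearMap.toMatrix (b.baseChange S) (b'.baseChange S) (e.toLinearMap.baseChange S) =
      (algebraMap K S).mapMatrix (LinearMap.toMatrix b b' e.toLinearMap) := by
    ext
    simp [LinearMap.toMatrix_apply, Algebra.algebraMap_eq_smul_one]
  rw [h, ← RingHom.map_det]
  rfl

/-- the linear-algebra content of the period computation
`c⁺(M ⊗ N) = c⁺(M)^μ c⁻(M)^ν det(I_N) mod 𝔉ˣ` for a tensor product of motives. -/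
theorem tensor_period_formula
    (hHB : finrank ℚ HB = 2) (hHdR : finrank ℚ HdR = 2)
    (Finf : HB →ₗ[ℚ] HB) (hFinv : Finf ∘ₗ Finf = LinearMap.id)
    (hBp : finrank ℚ ↥(Module.End.eigenspace Finf 1) = 1)
    (hBm : finrank ℚ ↥(Module.End.eigenspace Finf (-1)) = 1)
    (F0 : Submodule ℚ HdR) (hF0 : finrank ℚ ↥F0 = 1)
    (IM : (ℂ ⊗[ℚ] HB) ≃ₗ[ℂ] (ℂ ⊗[ℚ] HdR))
    (hαp : Function.Bijective (periodMap F0 IM (Module.End.eigenspace Finf 1)))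
    (hαm : Function.Bijective (periodMap F0 IM (Module.End.eigenspace Finf (-1))))
    (Bp : Basis (Fin 1) ℚ ↥(Module.End.eigenspace Finf 1))
    (Bm : Basis (Fin 1) ℚ ↥(Module.End.eigenspace Finf (-1)))
    (BdRQ : Basis (Fin 1) ℚ (HdR ⧸ F0))
    (cp cm : ℂ)
    (hcp : periodMap F0 IM (Module.End.eigenspace Finf 1) ((1 : ℂ) ⊗ₜ[ℚ] Bp 0)
      = cp • ((1 : ℂ) ⊗ₜ[ℚ] BdRQ 0))
    (hcm : periodMap F0 IM (Module.End.eigenspace Finf (-1)) ((1 : ℂ) ⊗ₜ[ℚ] Bm 0)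
      = cm • ((1 : ℂ) ⊗ₜ[ℚ] BdRQ 0))
    (d : ℕ) (hWB : finrank 𝔉 WB = d) (hWdR : finrank 𝔉 WdR = d)
    (Ginf : WB →ₗ[𝔉] WB) (hGinv : Ginf ∘ₗ Ginf = LinearMap.id)
    (hA : Function.Bijective (Algebra.TensorProduct.productMap
      (IsScalarTower.toAlgHom ℚ 𝔉 A) (IsScalarTower.toAlgHom ℚ ℂ A)))
    (IN : (A ⊗[𝔉] WB) ≃ₗ[A] (A ⊗[𝔉] WdR))
    (BWB : Basis (Fin d) 𝔉 WB) (BWdR : Basis (Fin d) 𝔉 WdR) :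
    finrank 𝔉 ↥(Module.End.eigenspace (tensorInvolution 𝔉 Finf Ginf) 1) = d ∧
    Function.Bijective (tensorPeriodMap 𝔉 A F0 IM IN Finf Ginf) ∧
    ∀ (BT : Basis (Fin d) 𝔉 ↥(Module.End.eigenspace (tensorInvolution 𝔉 Finf Ginf) 1))
      (BQ : Basis (Fin d) 𝔉 ((WdR ⊗[ℚ] HdR) ⧸ tensorFil 𝔉 F0)),
      ∃ lam : 𝔉ˣ,
        (LinearMap.toMatrix (BT.baseChange A) (BQ.baseChange A)
            (tensorPeriodMap 𝔉 A F0 IM IN Finf Ginf)).det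
          = algebraMap 𝔉 A lam
            * algebraMap ℂ A
                (cp ^ (finrank 𝔉 ↥(Module.End.eigenspace Ginf 1))
                  * cm ^ (finrank 𝔉 ↥(Module.End.eigenspace Ginf (-1))))
            * (LinearMap.toMatrix (BWB.baseChange A) (BWdR.baseChange A) IN.toLinearMap).det := by
  obtain ⟨e, he⟩ := exists_equiv_eigenspace_tensorInvolution 𝔉 hFinv Bp Bm hGinv
  obtain ⟨q, hq⟩ := exists_equiv_quotient_tensorFil (WdR := WdR) 𝔉 F0 BdRQ
  have hcp0 : cp ≠ 0 := period_ne_zero hαp Bp hcp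
  have hcm0 : cm ≠ 0 := period_ne_zero hαm Bm hcm
  have : FiniteDimensional 𝔉 WB := BWB.finiteDimensional_of_finite
  set D : (A ⊗[𝔉] WB) →ₗ[A] (A ⊗[𝔉] WB) :=
    algebraMap ℂ A cp • (signProj Ginf 1).baseChange A +
      algebraMap ℂ A cm • (signProj Ginf (-1)).baseChange A with hD
  have hdetD := det_smul_signProj_baseChange hGinv (algebraMap ℂ A cp) (algebraMap ℂ A cm)
  rw [← hD] at hdetD
  have hDbij : Function.Bijective D := by
    rw [← End.isUnit_iff, LinearMap.isUnit_iff_isUnit_det, hdetD]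
    exact (((IsUnit.mk0 cp hcp0).map (algebraMap ℂ A)).pow _).mul
      (((IsUnit.mk0 cm hcm0).map (algebraMap ℂ A)).pow _)
  have hcomp : (q.baseChange 𝔉 A _ _).toLinearMap ∘ₗ tensorPeriodMap 𝔉 A F0 IM IN Finf Ginf ∘ₗ
      (e.baseChange 𝔉 A _ _).toLinearMap = IN.toLinearMap ∘ₗ D := by
    refine AlgebraTensorModule.curry_injective (LinearMap.ext_ring (LinearMap.ext fun w => ?_))
    let ψ : WdR ⊗[ℚ] HdR →ₗ[𝔉] WdR := q.toLinearMap ∘ₗ (tensorFil 𝔉 F0).mkQ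
    have hψ (w : WB) (h : HB) := baseChange_tensorComparison_tmul 𝔉 A IM IN
      (BdRQ.coord 0 ∘ₗ F0.mkQ) ψ hq w h
    have hsplit : q.toLinearMap.baseChange A (tensorPeriodMap 𝔉 A F0 IM IN Finf Ginf
        (1 ⊗ₜ e w)) = ψ.baseChange A (tensorComparison 𝔉 A IM IN (1 ⊗ₜ (e w : WB ⊗[ℚ] HB))) := by
      rw [LinearMap.baseChange_comp]
      rfl
    change q.toLinearMap.baseChange A (tensorPeriodMap 𝔉 A F0 IM IN Finf Ginf (1 ⊗ₜ e w)) =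
      IN (D (1 ⊗ₜ w))
    rw [hsplit, he, tmul_add, map_add, map_add, hψ, hψ,
      rid_baseChange_coord_mkQ F0 IM _ BdRQ _ _ hcp, rid_baseChange_coord_mkQ F0 IM _ BdRQ _ _ hcm]
    rw [hD, LinearMap.add_apply, LinearMap.smul_apply, LinearMap.smul_apply, map_add, map_smul,
      map_smul, LinearMap.baseChange_tmul, LinearMap.baseChange_tmul]
  have hfac : tensorPeriodMap 𝔉 A F0 IM IN Finf Ginf =
      (q.symm.baseChange 𝔉 A _ _).toLinearMap ∘ₗ (IN.toLinearMap ∘ₗ D) ∘ₗ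
        (e.symm.baseChange 𝔉 A _ _).toLinearMap := by
    rw [← hcomp]
    refine LinearMap.ext fun x => ?_
    change _ = (q.baseChange 𝔉 A _ _).symm (q.baseChange 𝔉 A _ _
      (tensorPeriodMap 𝔉 A F0 IM IN Finf Ginf
        (e.baseChange 𝔉 A _ _ ((e.baseChange 𝔉 A _ _).symm x))))
    rw [LinearEquiv.symm_apply_apply, LinearEquiv.apply_symm_apply]
  refine ⟨e.finrank_eq.symm.trans hWB, ?_, fun BT BQ => ?_⟩
  · rw [hfac]
    exact (q.symm.baseChange 𝔉 A _ _).bijective.comp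
      ((IN.bijective.comp hDbij).comp (e.symm.baseChange 𝔉 A _ _).bijective)
  · obtain ⟨u, hu⟩ := exists_unit_det_toMatrix_baseChange (S := A) BWdR BQ q.symm
    obtain ⟨v, hv⟩ := exists_unit_det_toMatrix_baseChange (S := A) BT BWB e.symm
    refine ⟨u * v, ?_⟩
    rw [← LinearMap.det_toMatrix (BWB.baseChange A)] at hdetD
    rw [hfac, LinearMap.toMatrix_comp _ (BWdR.baseChange A),
      LinearMap.toMatrix_comp _ (BWB.baseChange A) (BWdR.baseChange A),
      LinearMap.toMatrix_comp _ (BWB.baseChange A) (BWdR.baseChange A),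
      Matrix.det_mul, Matrix.det_mul, Matrix.det_mul, hdetD, LinearEquiv.coe_baseChange,
      LinearEquiv.coe_baseChange, hu, hv]
    simp only [Units.val_mul, map_mul, map_pow]
    ring

end PeriodSetup

end
end

section
/- Let q1, q2, r be distinct odd primes and let G = (C_{q1} × C_{q2}) ⋊_φ C_r be a semidirect product in which the composite of φ : C_r → Aut(C_{q1} × C_{q2}) = Aut(C_{q1}) × Aut(C_{q2}) with the projection to Aut(C_{q1}) is injective, and likewise its composite with the projection to Aut(C_{q2}) is injective. Write N = C_{q1} × C_{q2}, C = {1} ⋊ C_r, H1 = (C_{q1} × {1}) ⋊ C_r and H2 = ({1} × C_{q2}) ⋊ C_r, regarded as subgroups of G. Then for every g ∈ G: Σ_ψ (Ind_N^G ψ)(g) + r·π_{H1}(g) + r·π_{H2}(g) = r + r·π_C(g), where the sum runs over all (q1−1)(q2−1) faithful one-dimensional characters ψ of N. -/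
open scoped BigOperators

/-- The permutation character `π_H` of a subgroup `H ≤ G`: `π_H(g)` is the number of cosets
`xH ∈ G/H` fixed by `g`; it is the character of `Ind_H^G 1`. -/
noncomputable def permChar {G : Type*} [Group G] (H : Subgroup G) (g : G) : ℂ :=
  (Nat.card {x : G ⧸ H // g • x = x} : ℂ)

/-- Combine homomorphisms `C_r → Aut(A)` and `C_r → Aut(B)` into a homomorphism
`C_r → Aut(A × B)`, realising the identification `Aut(A) × Aut(B) ⊆ Aut(A × B)`. -/
def prodAutHom {H A B : Type*} [Group H] [Group A] [Group B]
    (φ1 : H →* MulAut A) (φ2 : H →* MulAut B) : H →* MulAut (A × B) where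
  toFun h := (φ1 h).prodCongr (φ2 h)
  map_one' := by
    ext x <;> simp [MulEquiv.prodCongr, MulAut.one_apply]
  map_mul' h1 h2 := by
    ext x <;> simp [MulEquiv.prodCongr, MulAut.mul_apply]

noncomputable instance {N G : Type*} [Group N] [Group G] {φ : G →* MulAut N}
    [Fintype N] [Fintype G] : Fintype (N ⋊[φ] G) :=
  Fintype.ofEquiv (N × G)
    ⟨fun p => ⟨p.1, p.2⟩, fun g => (g.left, g.right), fun _ => rfl, fun _ => rfl⟩

/-- The induced character `Ind_N^G ψ` of a one-dimensional character `ψ` of the normal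
subgroup `N` of `G = N ⋊[φ] H`, computed by the standard formula
`(Ind ψ)(g) = |N|⁻¹ Σ_{x ∈ G} ψ̇(x⁻¹ g x)` (with `ψ̇` the extension of `ψ` by zero), which
agrees with `Σ_{xN ∈ G/N} ψ(x⁻¹ g x)` for `g ∈ N` and vanishes off `N`. -/
noncomputable def sdIndChar {N H : Type*} [Group N] [Group H] [Fintype N] [Fintype H]
    [DecidableEq H] {φ : H →* MulAut N} (ψ : N →* ℂˣ) (g : N ⋊[φ] H) : ℂ :=
  (Fintype.card N : ℂ)⁻¹ *
    ∑ x : N ⋊[φ] H, if (x⁻¹ * g * x).right = 1 then (ψ ((x⁻¹ * g * x).left) : ℂ) else 0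

section FixedPoints

/-- If `f : G → X` is surjective with fibres the left cosets of `K`, and left multiplication by `g`
on `G` covers `T : X → X`, then `π_K(g)` is the number of fixed points of `T`. -/
theorem permChar_eq_card_fixedPoints {G X : Type*} [Group G] (K : Subgroup G) (g : G)
    (f : G → X) (hf : Function.Surjective f) (hK : ∀ x y, x⁻¹ * y ∈ K ↔ f x = f y)
    (T : X → X) (hT : ∀ x, f (g * x) = T (f x)) :
    permChar K g = (Nat.card {x : X // T x = x} : ℂ) := by
  have hlift : ∀ x y : G, QuotientGroup.leftRel K x y → f x = f y := fun x y h =>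
    (hK x y).1 (QuotientGroup.leftRel_apply.1 h)
  let F : G ⧸ K → X := Quotient.lift f hlift
  have hF : Function.Bijective F := by
    constructor
    · intro a b
      induction a using QuotientGroup.induction_on with | H x => ?_
      induction b using QuotientGroup.induction_on with | H y => ?_
      exact fun h => QuotientGroup.eq.2 ((hK x y).2 h)
    · intro x
      obtain ⟨y, rfl⟩ := hf x
      exact ⟨(y : G ⧸ K), rfl⟩
  have hFT : ∀ a, F (g • a) = T (F a) := by
    intro a
    induction a using QuotientGroup.induction_on with | H x => ?_
    exact hT x
  unfold permChar
  congr 1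
  refine Nat.card_congr ((Equiv.ofBijective F hF).subtypeEquiv fun a => ?_)
  rw [Equiv.ofBijective_apply, ← hFT, hF.1.eq_iff]

/-- An affine map `a ↦ c * α a` of a group of prime order with `α ≠ 1` has exactly one fixed
point. -/
theorem card_fixedPoints_affine_of_ne_one {A : Type*} [CommGroup A] (hA : (Nat.card A).Prime)
    (c : A) {α : MulAut A} (hα : α ≠ 1) : Nat.card {a : A // c * α a = a} = 1 := by
  have : Fact (Nat.card A).Prime := ⟨hA⟩
  have : Finite A := Nat.finite_of_card_ne_zero hA.ne_zero
  let d : A →* A := MonoidHom.id A / α.toMonoidHom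
  have hd : ∀ a, d a = a / α a := fun a => rfl
  have hker : d.ker = ⊥ := by
    refine (d.ker.eq_bot_or_eq_top_of_prime_card).resolve_right fun h => hα ?_
    ext a
    have : a ∈ d.ker := h ▸ Subgroup.mem_top a
    rw [MonoidHom.mem_ker, hd, div_eq_one] at this
    exact this.symm
  have hbij : Function.Bijective d :=
    Finite.injective_iff_bijective.1 ((MonoidHom.ker_eq_bot_iff d).1 hker)
  obtain ⟨a, ha, huniq⟩ := hbij.existsUnique c
  have hiff : ∀ b, c * α b = b ↔ d b = c := fun b => by
    rw [hd, div_eq_iff_eq_mul, eq_comm]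
  rw [Nat.card_eq_one_iff_unique]
  exact ⟨⟨fun x y => Subtype.ext ((huniq _ ((hiff _).1 x.2)).trans
    (huniq _ ((hiff _).1 y.2)).symm)⟩, ⟨⟨a, (hiff a).2 ha⟩⟩⟩

theorem card_fixedPoints_mul_left {A : Type*} [Group A] [DecidableEq A] (c : A) :
    Nat.card {a : A // c * a = a} = if c = 1 then Nat.card A else 0 := by
  simp only [mul_eq_right]
  split_ifs with h
  · exact Nat.card_congr (Equiv.subtypeUnivEquiv fun _ => h)
  · simp [h]

end FixedPoints

section Characters

/-- Orthogonality: summing the nontrivial characters of a finite abelian group. -/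
theorem sum_ne_one_char_apply {A : Type*} [CommGroup A] [Finite A] [DecidableEq A]
    [Fintype (A →* ℂˣ)] [DecidableEq (A →* ℂˣ)] (a : A) :
    ∑ χ : A →* ℂˣ, (if χ ≠ 1 then (χ a : ℂ) else 0) =
      ((if a = 1 then Nat.card A else 0 : ℕ) : ℂ) - 1 := by
  have hall : ∑ χ : A →* ℂˣ, (χ a : ℂ) = ((if a = 1 then Nat.card A else 0 : ℕ) : ℂ) := by
    split_ifs with h
    · simp [h, ← Nat.card_eq_fintype_card,
        CommGroup.card_monoidHom_of_hasEnoughRootsOfUnity A ℂ]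
    · obtain ⟨χ₀, hχ₀⟩ := CommGroup.exists_apply_ne_one_of_hasEnoughRootsOfUnity A ℂ h
      have hmul : (χ₀ a : ℂ) * ∑ χ : A →* ℂˣ, (χ a : ℂ) = ∑ χ : A →* ℂˣ, (χ a : ℂ) := by
        rw [Finset.mul_sum]
        exact Fintype.sum_equiv (Equiv.mulLeft χ₀) _ _ fun χ => by simp
      have hne : (χ₀ a : ℂ) ≠ 1 := fun h' => hχ₀ (Units.ext h')
      simpa using (mul_left_eq_self₀.1 hmul).resolve_left hne
  have hsplit : ∀ χ : A →* ℂˣ, (if χ ≠ 1 then (χ a : ℂ) else 0) =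
      (χ a : ℂ) - if χ = 1 then 1 else 0 := by
    intro χ
    by_cases h : χ = 1 <;> simp [h]
  simp only [hsplit, Finset.sum_sub_distrib, hall]
  simp

/-- A character of a product of two groups is a pair of characters. -/
def charProdEquiv (A B M : Type*) [CommGroup A] [CommGroup B] [CommGroup M] :
    (A →* M) × (B →* M) ≃ (A × B →* M) where
  toFun p := p.1.coprod p.2
  invFun ψ := (ψ.comp (MonoidHom.inl A B), ψ.comp (MonoidHom.inr A B))
  left_inv p := by simp
  right_inv ψ := by ext x; simp

theorem MonoidHom.injective_of_prime_card {A M : Type*} [Group A] [Group M]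
    (hA : (Nat.card A).Prime) {χ : A →* M} (hχ : χ ≠ 1) : Function.Injective χ := by
  have : Fact (Nat.card A).Prime := ⟨hA⟩
  refine (MonoidHom.ker_eq_bot_iff χ).1 ((χ.ker.eq_bot_or_eq_top_of_prime_card).resolve_right
    fun h => hχ ?_)
  ext a
  exact MonoidHom.mem_ker.1 (h ▸ Subgroup.mem_top a)

theorem injective_coprod_iff {A B M : Type*} [CommGroup A] [CommGroup B] [CommGroup M]
    (hA : (Nat.card A).Prime) (hB : (Nat.card B).Prime) (hAB : Nat.card A ≠ Nat.card B)
    (χ : A →* M) (η : B →* M) :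
    Function.Injective (χ.coprod η) ↔ χ ≠ 1 ∧ η ≠ 1 := by
  have : Nontrivial A := (Nat.card_pos_iff.1 hA.pos).2.one_lt_card_iff_nontrivial.1 hA.one_lt
  have : Nontrivial B := (Nat.card_pos_iff.1 hB.pos).2.one_lt_card_iff_nontrivial.1 hB.one_lt
  constructor
  · intro h
    constructor
    · rintro rfl
      obtain ⟨a, ha⟩ := exists_ne (1 : A)
      exact ha (congrArg Prod.fst (@h (a, 1) (1, 1) (by simp)))
    · rintro rfl
      obtain ⟨b, hb⟩ := exists_ne (1 : B)
      exact hb (congrArg Prod.snd (@h (1, b) (1, 1) (by simp)))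
  · rintro ⟨hχ, hη⟩
    rw [injective_iff_map_eq_one]
    rintro ⟨a, b⟩ hab
    rw [MonoidHom.coprod_apply] at hab
    have hdvdA : orderOf (χ a) ∣ Nat.card A := (orderOf_map_dvd χ a).trans (orderOf_dvd_natCard a)
    have hdvdB : orderOf (χ a) ∣ Nat.card B := by
      rw [eq_inv_of_mul_eq_one_left hab, orderOf_inv]
      exact (orderOf_map_dvd η b).trans (orderOf_dvd_natCard b)
    have hχa : χ a = 1 := orderOf_eq_one_iff.1
      (Nat.eq_one_of_dvd_coprimes ((Nat.coprime_primes hA hB).2 hAB) hdvdA hdvdB)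
    have hηb : η b = 1 := by rwa [hχa, one_mul] at hab
    exact Prod.ext ((injective_iff_map_eq_one χ).1 (χ.injective_of_prime_card hA hχ) a hχa)
      ((injective_iff_map_eq_one η).1 (η.injective_of_prime_card hB hη) b hηb)

/-- Orthogonality: summing the faithful characters of a product of two groups of distinct prime
orders. -/
theorem sum_faithful_char_apply {A B : Type*} [CommGroup A] [CommGroup B]
    [DecidableEq A] [DecidableEq B]
    (hA : (Nat.card A).Prime) (hB : (Nat.card B).Prime) (hAB : Nat.card A ≠ Nat.card B)
    [Fintype (A × B →* ℂˣ)] [∀ ψ : A × B →* ℂˣ, Decidable (Function.Injective ψ)] (n : A × B) :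
    ∑ ψ : A × B →* ℂˣ, (if Function.Injective ψ then (ψ n : ℂ) else 0) =
      (((if n.1 = 1 then Nat.card A else 0 : ℕ) : ℂ) - 1) *
        (((if n.2 = 1 then Nat.card B else 0 : ℕ) : ℂ) - 1) := by
  classical
  have : Finite A := Nat.finite_of_card_ne_zero hA.ne_zero
  have : Finite B := Nat.finite_of_card_ne_zero hB.ne_zero
  have := Fintype.ofFinite (A →* ℂˣ)
  have := Fintype.ofFinite (B →* ℂˣ)
  rw [← sum_ne_one_char_apply, ← sum_ne_one_char_apply, Fintype.sum_mul_sum,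
    ← Fintype.sum_prod_type', ← Equiv.sum_comp (charProdEquiv A B ℂˣ)]
  refine Finset.sum_congr rfl fun p _ => ?_
  change (if Function.Injective (p.1.coprod p.2) then ((p.1.coprod p.2 n : ℂˣ) : ℂ) else 0) = _
  simp only [injective_coprod_iff hA hB hAB]
  by_cases h1 : p.1 = 1 <;> by_cases h2 : p.2 = 1 <;> simp [h1, h2]

end Characters

section Semidirect

variable {A B H : Type*} [CommGroup A] [CommGroup B] [Group H]
  {φ1 : H →* MulAut A} {φ2 : H →* MulAut B}

@[simp]
theorem prodAutHom_apply_fst (h : H) (x : A × B) : (prodAutHom φ1 φ2 h x).1 = φ1 h x.1 := rfl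

@[simp]
theorem prodAutHom_apply_snd (h : H) (x : A × B) : (prodAutHom φ1 φ2 h x).2 = φ2 h x.2 := rfl

/-- If `p : N → M` is a surjective homomorphism intertwining the actions `φ` and `θ` of `H`, then
the permutation character of `ker p ⋊ H` counts the fixed points of the affine action on `M`. -/
theorem permChar_closure_ker {N M : Type*} [Group N] [Group M]
    {φ : H →* MulAut N} (θ : H →* MulAut M) (p : N →* M) (hp : Function.Surjective p)
    (hφ : ∀ h n, p (φ h n) = θ h (p n)) (g : N ⋊[φ] H) :
    permChar (Subgroup.closure {x : N ⋊[φ] H | p x.left = 1}) g =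
      (Nat.card {m : M // p g.left * θ g.right m = m} : ℂ) := by
  let K : Subgroup (N ⋊[φ] H) :=
    { carrier := {x | p x.left = 1}
      one_mem' := by simp
      mul_mem' := fun {x y} hx hy => by
        simp only [Set.mem_ofPred_eq] at hx hy ⊢
        simp [hφ, hx, hy]
      inv_mem' := fun {x} hx => by
        simp only [Set.mem_ofPred_eq] at hx ⊢
        rw [SemidirectProduct.inv_left, hφ, map_inv p, hx, inv_one, map_one] }
  have hK : Subgroup.closure {x : N ⋊[φ] H | p x.left = 1} = K := Subgroup.closure_eq K
  rw [hK]
  refine permChar_eq_card_fixedPoints K g (fun x => p x.left) (fun m => ?_) (fun x y => ?_) _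
    fun x => by simp [hφ]
  · obtain ⟨n, rfl⟩ := hp m
    exact ⟨⟨n, 1⟩, rfl⟩
  · change p (x⁻¹ * y).left = 1 ↔ _
    rw [SemidirectProduct.mul_left, SemidirectProduct.inv_left, SemidirectProduct.inv_right,
      ← map_mul, hφ, MulEquiv.map_eq_one_iff, map_mul, map_inv, inv_mul_eq_one]

theorem conj_right_eq_one_iff {N : Type*} [Group N] {φ : H →* MulAut N} (x g : N ⋊[φ] H) :
    (x⁻¹ * g * x).right = 1 ↔ g.right = 1 := by
  simp [mul_assoc, inv_mul_eq_one]

theorem conj_left_of_right_eq_one {N : Type*} [CommGroup N] {φ : H →* MulAut N}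
    (x g : N ⋊[φ] H) (hg : g.right = 1) :
    (x⁻¹ * g * x).left = φ x.right⁻¹ g.left := by
  simp [hg]

/-- The sum over faithful characters of `A × B` of the induced characters, in terms of fixed
points of the affine actions on `A` and on `B`. -/
theorem finsum_faithful_sdIndChar [Fintype A] [Fintype B] [Fintype H] [DecidableEq H]
    (hA : (Nat.card A).Prime) (hB : (Nat.card B).Prime) (hAB : Nat.card A ≠ Nat.card B)
    (hφ1 : Function.Injective φ1) (g : (A × B) ⋊[prodAutHom φ1 φ2] H) :
    ∑ᶠ ψ ∈ {ψ : A × B →* ℂˣ | Function.Injective ψ}, sdIndChar ψ g =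
      Fintype.card H * (((Nat.card {a : A // g.left.1 * φ1 g.right a = a} : ℂ) - 1) *
        ((Nat.card {b : B // g.left.2 * φ2 g.right b = b} : ℂ) - 1)) := by
  classical
  by_cases hg : g.right = 1
  · have := Fintype.ofFinite (A × B →* ℂˣ)
    have hsum : ∀ x : (A × B) ⋊[prodAutHom φ1 φ2] H,
        ∑ ψ : A × B →* ℂˣ,
          (if Function.Injective ψ then (ψ (x⁻¹ * g * x).left : ℂ) else 0) =
        ((Nat.card {a : A // g.left.1 * φ1 g.right a = a} : ℂ) - 1) *
        ((Nat.card {b : B // g.left.2 * φ2 g.right b = b} : ℂ) - 1) := by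
      intro x
      rw [sum_faithful_char_apply hA hB hAB, conj_left_of_right_eq_one x g hg]
      simp only [hg, map_one, MulAut.one_apply, card_fixedPoints_mul_left, prodAutHom_apply_fst,
        prodAutHom_apply_snd, MulEquiv.map_eq_one_iff]
    have hN : (Fintype.card (A × B) : ℂ) ≠ 0 := Nat.cast_ne_zero.2 Fintype.card_ne_zero
    have hG : Fintype.card ((A × B) ⋊[prodAutHom φ1 φ2] H) =
        Fintype.card (A × B) * Fintype.card H := by
      simp only [← Nat.card_eq_fintype_card, SemidirectProduct.card]
    simp only [finsum_eq_sum_of_fintype, finsum_eq_if, Set.mem_ofPred_eq, sdIndChar,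
      conj_right_eq_one_iff, if_pos hg, ← mul_ite_zero, ← Finset.mul_sum]
    rw [inv_mul_eq_iff_eq_mul₀ hN, ← mul_assoc, ← Nat.cast_mul, ← hG, ← nsmul_eq_mul,
      ← Finset.card_univ, ← Finset.sum_const, ← Finset.sum_congr rfl fun x _ => hsum x,
      Finset.sum_comm]
    refine Finset.sum_congr rfl fun ψ _ => ?_
    split_ifs <;> simp
  · rw [card_fixedPoints_affine_of_ne_one hA _ ((map_ne_one_iff φ1 hφ1).2 hg)]
    simp only [sdIndChar, conj_right_eq_one_iff, if_neg hg]
    simp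

end Semidirect

/-- Let `q1, q2, r` be distinct odd primes and
`G = (C_{q1} × C_{q2}) ⋊_φ C_r` with both components of `φ` injective. With
`N = C_{q1} × C_{q2}`, `C = 1 ⋊ C_r`, `H1 = (C_{q1} × 1) ⋊ C_r`, `H2 = (1 × C_{q2}) ⋊ C_r`,
one has, for every `g ∈ G`,
`Σ_ψ (Ind_N^G ψ)(g) + r·π_{H1}(g) + r·π_{H2}(g) = r + r·π_C(g)`,
the sum running over all faithful one-dimensional characters `ψ` of `N`. -/
theorem semidirect_faithful_induced_character_identity
    (q1 q2 r : ℕ) (hq1 : q1.Prime) (hq2 : q2.Prime) (hr : r.Prime)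
    (hq1odd : Odd q1) (hq2odd : Odd q2) (hrodd : Odd r)
    (h12 : q1 ≠ q2) (h1r : q1 ≠ r) (h2r : q2 ≠ r)
    [NeZero q1] [NeZero q2] [NeZero r]
    (φ1 : Multiplicative (ZMod r) →* MulAut (Multiplicative (ZMod q1)))
    (φ2 : Multiplicative (ZMod r) →* MulAut (Multiplicative (ZMod q2)))
    (hφ1 : Function.Injective φ1) (hφ2 : Function.Injective φ2) :
    ∀ g : (Multiplicative (ZMod q1) × Multiplicative (ZMod q2))
        ⋊[prodAutHom φ1 φ2] Multiplicative (ZMod r),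
      (∑ᶠ ψ ∈ {ψ : (Multiplicative (ZMod q1) × Multiplicative (ZMod q2)) →* ℂˣ |
          Function.Injective ψ}, sdIndChar ψ g)
        + r * permChar (Subgroup.closure {x | x.left.2 = 1}) g
        + r * permChar (Subgroup.closure {x | x.left.1 = 1}) g
      = r + r * permChar (Subgroup.closure {x | x.left = 1}) g := by
  intro g
  have hA : Nat.card (Multiplicative (ZMod q1)) = q1 := by simp
  have hB : Nat.card (Multiplicative (ZMod q2)) = q2 := by simp
  have hH : Fintype.card (Multiplicative (ZMod r)) = r := by simp
  have hsum := finsum_faithful_sdIndChar (hA.symm ▸ hq1) (hB.symm ▸ hq2)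
    (by rwa [hA, hB]) hφ1 g
  have hπ1 := permChar_closure_ker φ2 (MonoidHom.snd _ _) Prod.snd_surjective
    (fun _ _ => rfl) g
  have hπ2 := permChar_closure_ker φ1 (MonoidHom.fst _ _) Prod.fst_surjective
    (fun _ _ => rfl) g
  have hπ := permChar_closure_ker (prodAutHom φ1 φ2) (MonoidHom.id _) Function.surjective_id
    (fun _ _ => rfl) g
  have hprod : Nat.card {n // g.left * prodAutHom φ1 φ2 g.right n = n} =
      Nat.card {a // g.left.1 * φ1 g.right a = a} *
        Nat.card {b // g.left.2 * φ2 g.right b = b} := by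
    rw [← Nat.card_prod]
    exact Nat.card_congr ((Equiv.subtypeEquivRight fun n => Prod.ext_iff).trans
      (Equiv.subtypeProdEquivProd (p := fun a => g.left.1 * φ1 g.right a = a)
        (q := fun b => g.left.2 * φ2 g.right b = b)))
  simp only [MonoidHom.coe_fst, MonoidHom.coe_snd, MonoidHom.id_apply] at hπ1 hπ2 hπ
  rw [hsum, hπ1, hπ2, hπ, hprod, hH]
  push_cast
  ring
end

section
/- Let q1, q2, ℓ be distinct primes such that ℓ has multiplicative order exactly 3 modulo q1, q1 ≢ 1 (mod 9), and q2 is a cube modulo q1. Then for every nonzero rational number x, every integer n not divisible by 3, all integers a and b, and every rational number m whose q1-adic valuation is zero and which, written in lowest terms as m = u/v, satisfies q1 | (u − v), one has x³·ℓ^n ≠ q1^a · q2^b · m. -/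
/-- If the cube of a unit modulo a prime `p` equals `l ^ n`, where `l` has order `3` and `3 ∤ n`,
then that unit has order `9`, so `9 ∣ p - 1`. -/
lemma nine_dvd_sub_one_of_cube_eq_zpow {p : ℕ} [Fact p.Prime] {g l : (ZMod p)ˣ}
    (hl : orderOf l = 3) {n : ℤ} (hn : ¬ (3 : ℤ) ∣ n) (h : g ^ 3 = l ^ n) : 9 ∣ p - 1 := by
  have hg3 : ¬ g ^ 3 ^ 1 = 1 := by
    rw [pow_one, h, ← orderOf_dvd_iff_zpow_eq_one, hl]
    exact_mod_cast hn
  have hg9 : g ^ 3 ^ (1 + 1) = 1 := by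
    rw [show 3 ^ (1 + 1) = 3 * 3 from rfl, pow_mul, h, ← zpow_natCast, zpow_comm, zpow_natCast,
      ← hl, pow_orderOf_eq_one, one_zpow]
  have : Fact (Nat.Prime 3) := ⟨Nat.prime_three⟩
  have hord : orderOf g = 9 := orderOf_eq_prime_pow hg3 hg9
  rw [← hord, ← ZMod.card_units p]
  exact orderOf_dvd_card

lemma Padic.exists_zpow_mul_unit {p : ℕ} [Fact p.Prime] {x : ℚ_[p]} (hx : x ≠ 0) :
    ∃ (k : ℤ) (u : ℤ_[p]ˣ), x = (p : ℚ_[p]) ^ k * ((u : ℤ_[p]) : ℚ_[p]) := by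
  have hp : (p : ℚ_[p]) ≠ 0 := by exact_mod_cast (Fact.out : p.Prime).ne_zero
  have hp' : (p : ℝ) ≠ 0 := by exact_mod_cast (Fact.out : p.Prime).ne_zero
  have hnorm : ‖(p : ℚ_[p]) ^ (-x.valuation) * x‖ = 1 := by
    rw [norm_mul, Padic.norm_p_zpow, Padic.norm_eq_zpow_neg_valuation hx, ← zpow_add₀ hp']
    simp
  refine ⟨x.valuation, PadicInt.mkUnits hnorm, ?_⟩
  rw [PadicInt.mkUnits_eq, ← mul_assoc, ← zpow_add₀ hp]
  simp

lemma PadicInt.exists_unit_eq_intCast {p : ℕ} [Fact p.Prime] {z : ℤ} (hz : ¬ (p : ℤ) ∣ z) :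
    ∃ u : ℤ_[p]ˣ, (u : ℤ_[p]) = z := by
  have : IsUnit (z : ℤ_[p]) := by
    rw [PadicInt.isUnit_iff]
    refine le_antisymm (PadicInt.norm_le_one _) (not_lt.mp ?_)
    rwa [PadicInt.norm_int_lt_one_iff_dvd]
  exact this

/-- Units of `ℤ_[p]` which differ by a power of `p` in `ℚ_[p]` are equal. -/
lemma PadicInt.unit_eq_of_coe_eq_zpow_mul {p : ℕ} [Fact p.Prime] {u v : ℤ_[p]ˣ} {k : ℤ}
    (h : ((u : ℤ_[p]) : ℚ_[p]) = (p : ℚ_[p]) ^ k * ((v : ℤ_[p]) : ℚ_[p])) : u = v := by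
  have hp : 1 < (p : ℝ) := by exact_mod_cast (Fact.out : p.Prime).one_lt
  have hk : k = 0 := by
    have hn := congrArg norm h
    rw [norm_mul, Padic.norm_p_zpow, ← PadicInt.norm_def, ← PadicInt.norm_def,
      PadicInt.norm_units, PadicInt.norm_units, mul_one, eq_comm,
      zpow_eq_one_iff_right₀ (by linarith) hp.ne'] at hn
    omega
  rw [hk, zpow_zero, one_mul] at h
  exact Units.ext (Subtype.ext h)

lemma PadicInt.coe_unit_zpow {p : ℕ} [Fact p.Prime] (u : ℤ_[p]ˣ) (n : ℤ) :
    (((u ^ n : ℤ_[p]ˣ) : ℤ_[p]) : ℚ_[p]) = ((u : ℤ_[p]) : ℚ_[p]) ^ n :=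
  (congrArg Units.val (map_zpow (Units.map (PadicInt.Coe.ringHom (p := p)).toMonoidHom) u n)).trans
    (Units.val_zpow_eq_zpow_val _ _)


/-- Let `q1, q2, ℓ` be distinct primes with `ℓ` of multiplicative order `3`
mod `q1`, `q1 ≢ 1 (mod 9)`, and `q2` a cube mod `q1`. Then for every nonzero rational `x`,
every integer `n` with `3 ∤ n`, all integers `a, b`, and every rational `m` with `q1`-adic
valuation `0` (i.e. `q1` divides neither numerator nor denominator of `m`) satisfying
`q1 ∣ (num m − den m)` (written in lowest terms), one has `x³·ℓⁿ ≠ q1^a·q2^b·m`. -/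
theorem cube_times_ell_pow_ne_norm_shape
    (q1 q2 ℓ : ℕ) (hq1 : q1.Prime) (hq2 : q2.Prime) (hℓ : ℓ.Prime)
    (h12 : q1 ≠ q2) (h1ℓ : q1 ≠ ℓ) (h2ℓ : q2 ≠ ℓ)
    (hord : orderOf (ℓ : ZMod q1) = 3)
    (h9 : q1 % 9 ≠ 1)
    (hcube : ∃ c : ZMod q1, c ^ 3 = (q2 : ZMod q1)) :
    ∀ x : ℚ, x ≠ 0 → ∀ n : ℤ, ¬ (3 : ℤ) ∣ n → ∀ a b : ℤ, ∀ m : ℚ,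
      ¬ (q1 : ℤ) ∣ m.num → ¬ (q1 : ℤ) ∣ (m.den : ℤ) → (q1 : ℤ) ∣ (m.num - (m.den : ℤ)) →
      x ^ 3 * (ℓ : ℚ) ^ n ≠ (q1 : ℚ) ^ a * (q2 : ℚ) ^ b * m := by
  intro x hx n hn a b m hnum hden hsub heq
  have : Fact q1.Prime := ⟨hq1⟩
  have hnd {r : ℕ} (hr : r.Prime) (hne : q1 ≠ r) : ¬ (q1 : ℤ) ∣ (r : ℤ) := fun h =>
    hne ((Nat.prime_dvd_prime_iff_eq hq1 hr).1 (by exact_mod_cast h))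
  obtain ⟨L, hL⟩ := PadicInt.exists_unit_eq_intCast (hnd hℓ h1ℓ)
  obtain ⟨Q, hQ⟩ := PadicInt.exists_unit_eq_intCast (hnd hq2 h12)
  obtain ⟨N, hN⟩ := PadicInt.exists_unit_eq_intCast hnum
  obtain ⟨D, hD⟩ := PadicInt.exists_unit_eq_intCast hden
  obtain ⟨k, U, hU⟩ := Padic.exists_zpow_mul_unit (p := q1) (x := (x : ℚ_[q1]))
    (by exact_mod_cast hx)
  have hp : (q1 : ℚ_[q1]) ≠ 0 := by exact_mod_cast hq1.ne_zero
  have hLc : ((L : ℤ_[q1]) : ℚ_[q1]) = (ℓ : ℚ_[q1]) := by simp [hL]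
  have hQc : ((Q : ℤ_[q1]) : ℚ_[q1]) = (q2 : ℚ_[q1]) := by simp [hQ]
  have hNc : ((N : ℤ_[q1]) : ℚ_[q1]) = (m.num : ℚ_[q1]) := by simp [hN]
  have hDc : ((D : ℤ_[q1]) : ℚ_[q1]) = (m.den : ℚ_[q1]) := by simp [hD]
  have hmul : (m : ℚ_[q1]) * (m.den : ℚ_[q1]) = (m.num : ℚ_[q1]) := by
    exact_mod_cast congrArg (Rat.cast : ℚ → ℚ_[q1]) (Rat.mul_den_eq_num m)
  have heq' : (x : ℚ_[q1]) ^ 3 * (ℓ : ℚ_[q1]) ^ n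
      = (q1 : ℚ_[q1]) ^ a * (q2 : ℚ_[q1]) ^ b * (m : ℚ_[q1]) := by
    simpa using congrArg (Rat.cast : ℚ → ℚ_[q1]) heq
  have hunits : U ^ 3 * L ^ n * D = Q ^ b * N := by
    refine PadicInt.unit_eq_of_coe_eq_zpow_mul (k := a - 3 * k) ?_
    simp only [Units.val_mul, Units.val_pow_eq_pow_val, PadicInt.coe_mul, PadicInt.coe_pow,
      PadicInt.coe_unit_zpow, hLc, hQc, hNc, hDc]
    rw [hU, mul_pow, ← zpow_natCast, ← zpow_mul] at heq'
    rw [← hmul, zpow_sub₀ hp, mul_comm 3 k]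
    have hpk := zpow_ne_zero (k * 3) hp
    push_cast at heq'
    field_simp
    linear_combination heq'
  let red : ℤ_[q1]ˣ →* (ZMod q1)ˣ := Units.map (PadicInt.toZMod (p := q1)).toMonoidHom
  have hredL : (red L : ZMod q1) = ℓ := by simp [red, hL]
  have hredQ : (red Q : ZMod q1) = q2 := by simp [red, hQ]
  have hredND : red N = red D := by
    refine Units.ext ?_
    have := (ZMod.intCast_zmod_eq_zero_iff_dvd _ q1).2 hsub
    push_cast at this
    simpa [red, hN, hD] using sub_eq_zero.1 this
  obtain ⟨c, hc⟩ := hcube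
  have hc0 : c ≠ 0 := by
    rintro rfl
    refine (red Q).ne_zero ?_
    rw [hredQ, ← hc, zero_pow three_ne_zero]
  have hcQ : Units.mk0 c hc0 ^ 3 = red Q := Units.ext (by simp [hredQ, hc])
  have hred := congrArg red hunits
  simp only [map_mul, map_pow, map_zpow, hredND] at hred
  rw [mul_left_inj, ← hcQ] at hred
  have h9dvd : 9 ∣ q1 - 1 := by
    refine nine_dvd_sub_one_of_cube_eq_zpow (g := Units.mk0 c hc0 ^ b * (red U)⁻¹)
      (l := red L) (by rw [← orderOf_units, hredL, hord]) hn ?_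
    rw [mul_pow, inv_pow, mul_inv_eq_iff_eq_mul, mul_comm, hred,
      ← zpow_natCast, ← zpow_natCast, zpow_comm]
  have := hq1.one_lt
  omega
end

section
/- Let p and q be distinct odd primes and let G = D_{2pq} be the dihedral group of order 2pq, with (cyclic, normal) rotation subgroup C_{pq} of order pq and a fixed reflection s. Let C_2 = ⟨s⟩, let D_{2p} ≤ G be the dihedral subgroup of order 2p generated by the rotation of order p together with s, and let D_{2q} ≤ G be the dihedral subgroup of order 2q generated by the rotation of order q together with s. Then for every g ∈ G: Σ_ψ (Ind_{C_{pq}}^G ψ)(g) + 2·π_{D_{2p}}(g) + 2·π_{D_{2q}}(g) = 2 + 2·π_{C_2}(g), where the sum runs over all (p−1)(q−1) faithful one-dimensional characters ψ of C_{pq}. -/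
open scoped BigOperators

/-- The extension by zero of a one-dimensional character `ψ` of the rotation subgroup
`C_n = {r i}` of the dihedral group `D_{2n}`: it is `ψ(i)` on the rotation `r i` and `0` on
reflections. -/
def rotChar {n : ℕ} (ψ : Multiplicative (ZMod n) →* ℂˣ) : DihedralGroup n → ℂ
  | DihedralGroup.r i => (ψ (Multiplicative.ofAdd i) : ℂ)
  | DihedralGroup.sr _ => 0

/-- The induced character `Ind_{C_n}^{D_{2n}} ψ` of a one-dimensional character `ψ` of the
rotation subgroup `C_n ≤ D_{2n}`, computed by the standard formula
`(Ind ψ)(g) = |C_n|⁻¹ Σ_{x ∈ G} ψ̇(x⁻¹ g x)` (with `ψ̇` the extension of `ψ` by zero),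
which agrees with `Σ_{x C_n ∈ G/C_n} ψ(x⁻¹ g x)` for `g ∈ C_n` and vanishes off `C_n`. -/
noncomputable def dihedralIndChar {n : ℕ} [NeZero n]
    (ψ : Multiplicative (ZMod n) →* ℂˣ) (g : DihedralGroup n) : ℂ :=
  (n : ℂ)⁻¹ * ∑ x : DihedralGroup n, rotChar ψ (x⁻¹ * g * x)

open DihedralGroup

/-- The orbit map of the action of `DihedralGroup n` on `ZMod d`, for `d ∣ n`, at the point fixed
by the reflection `sr k`. -/
def rotClass {n d : ℕ} (h : d ∣ n) (k : ZMod n) : DihedralGroup n → ZMod d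
  | r i => ZMod.castHom h (ZMod d) i
  | sr j => ZMod.castHom h (ZMod d) (k - j)

theorem rotClass_eq_iff {n d : ℕ} (h : d ∣ n) (k : ZMod n) (x y : DihedralGroup n) :
    rotClass h k x = rotClass h k y ↔ rotClass h k (x⁻¹ * y) = 0 := by
  rcases x with a | a <;> rcases y with b | b <;>
    simp only [rotClass, inv_r, inv_sr, r_mul_r, r_mul_sr, sr_mul_r, sr_mul_sr, map_sub, map_add,
      map_neg] <;> constructor <;> grind

theorem rotClass_one {n d : ℕ} (h : d ∣ n) (k : ZMod n) : rotClass h k 1 = 0 :=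
  map_zero (ZMod.castHom h (ZMod d))

theorem rotClass_inv_eq_zero_iff {n d : ℕ} (h : d ∣ n) (k : ZMod n) (x : DihedralGroup n) :
    rotClass h k x⁻¹ = 0 ↔ rotClass h k x = 0 := by
  rw [← mul_one x⁻¹, ← rotClass_eq_iff, rotClass_one]

theorem mem_closure_r_sr_iff {n d : ℕ} (h : d ∣ n) (k : ZMod n) (x : DihedralGroup n) :
    x ∈ Subgroup.closure {r (d : ZMod n), sr k} ↔ rotClass h k x = 0 := by
  have hrot (i : ZMod n) (hi : ZMod.castHom h (ZMod d) i = 0) :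
      r i ∈ Subgroup.closure {r (d : ZMod n), sr k} := by
    obtain ⟨m, rfl⟩ := ZMod.intCast_surjective i
    rw [map_intCast, ZMod.intCast_zmod_eq_zero_iff_dvd] at hi
    obtain ⟨t, rfl⟩ := hi
    have := Subgroup.zpow_mem _ (Subgroup.subset_closure (k := {r (d : ZMod n), sr k})
      (Set.mem_insert _ _)) t
    simpa using this
  constructor
  · intro hx
    induction hx using Subgroup.closure_induction with
    | mem x hx =>
      rcases hx with rfl | rfl <;> simp [rotClass]
    | one => exact rotClass_one h k
    | mul x y _ _ hx hy =>
      rw [← inv_inv x, ← rotClass_eq_iff, hy, rotClass_inv_eq_zero_iff, hx]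
    | inv x _ hx => exact (rotClass_inv_eq_zero_iff h k x).2 hx
  · intro hx
    rcases x with i | j
    · exact hrot i hx
    · have hk : sr k ∈ Subgroup.closure {r (d : ZMod n), sr k} :=
        Subgroup.subset_closure (by simp)
      simpa using Subgroup.mul_mem _ (hrot (k - j) hx) hk

/-- The cosets of `⟨r d, sr k⟩` are indexed by the residues modulo `d`. -/
noncomputable def cosetEquiv {n d : ℕ} (h : d ∣ n) (k : ZMod n) :
    DihedralGroup n ⧸ Subgroup.closure {r (d : ZMod n), sr k} ≃ ZMod d :=
  Equiv.ofBijective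
    (Quotient.lift (rotClass h k) fun x y hxy => by
      rw [rotClass_eq_iff, ← mem_closure_r_sr_iff]
      exact QuotientGroup.leftRel_apply.1 hxy) <| by
    constructor
    · rintro ⟨x⟩ ⟨y⟩ hxy
      refine QuotientGroup.eq.2 ?_
      rw [mem_closure_r_sr_iff h, ← rotClass_eq_iff]
      exact hxy
    · intro a
      obtain ⟨i, rfl⟩ := ZMod.castHom_surjective h a
      exact ⟨(r i : DihedralGroup n), rfl⟩

theorem cosetEquiv_r_smul {n d : ℕ} (h : d ∣ n) (k i : ZMod n)
    (x : DihedralGroup n ⧸ Subgroup.closure {r (d : ZMod n), sr k}) :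
    cosetEquiv h k (r i • x) = ZMod.castHom h (ZMod d) i + cosetEquiv h k x := by
  obtain ⟨x, rfl⟩ := QuotientGroup.mk_surjective x
  change rotClass h k (r i * x) = _ + rotClass h k x
  rcases x with a | a
  · simp only [rotClass, r_mul_r, map_add]
  · simp only [rotClass, r_mul_sr, map_sub]
    ring

theorem cosetEquiv_sr_smul {n d : ℕ} (h : d ∣ n) (k j : ZMod n)
    (x : DihedralGroup n ⧸ Subgroup.closure {r (d : ZMod n), sr k}) :
    cosetEquiv h k (sr j • x) = ZMod.castHom h (ZMod d) (k - j) - cosetEquiv h k x := by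
  obtain ⟨x, rfl⟩ := QuotientGroup.mk_surjective x
  change rotClass h k (sr j * x) = _ - rotClass h k x
  rcases x with a | a <;> (simp only [rotClass, sr_mul_r, sr_mul_sr, map_add, map_sub]; ring)

theorem permChar_closure_r {n d : ℕ} [NeZero n] (h : d ∣ n) (k i : ZMod n) :
    permChar (Subgroup.closure {r (d : ZMod n), sr k}) (r i) = if d ∣ i.val then (d : ℂ) else 0 := by
  have hi : ZMod.castHom h (ZMod d) i = 0 ↔ d ∣ i.val := by
    conv_lhs => rw [← ZMod.natCast_zmod_val i]
    rw [map_natCast, ZMod.natCast_eq_zero_iff]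
  have hcard : Nat.card {x : DihedralGroup n ⧸ Subgroup.closure {r (d : ZMod n), sr k} //
      r i • x = x} = Nat.card {_a : ZMod d // d ∣ i.val} :=
    Nat.card_congr <| (cosetEquiv h k).subtypeEquiv fun x => by
      rw [← (cosetEquiv h k).apply_eq_iff_eq, cosetEquiv_r_smul, add_eq_right, hi]
  rw [permChar, hcard]
  split_ifs with hd <;> simp [hd]

theorem permChar_closure_sr {n d : ℕ} (h : d ∣ n) (hd : Odd d) (k j : ZMod n) :
    permChar (Subgroup.closure {r (d : ZMod n), sr k}) (sr j) = 1 := by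
  let u := ZMod.unitOfCoprime 2 (Nat.prime_two.coprime_iff_not_dvd.mpr hd.not_two_dvd_nat)
  have hu : (u : ZMod d) = 2 := by simp [u]
  have hcard : Nat.card {x : DihedralGroup n ⧸ Subgroup.closure {r (d : ZMod n), sr k} //
      sr j • x = x} = Nat.card {a : ZMod d // a = ↑u⁻¹ * ZMod.castHom h (ZMod d) (k - j)} :=
    Nat.card_congr <| (cosetEquiv h k).subtypeEquiv fun x => by
      rw [← (cosetEquiv h k).apply_eq_iff_eq, cosetEquiv_sr_smul, Units.eq_inv_mul_iff_mul_eq, hu,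
        two_mul, sub_eq_iff_eq_add, eq_comm]
  rw [permChar, hcard]
  simp

theorem dihedralIndChar_r {n : ℕ} [NeZero n] (ψ : Multiplicative (ZMod n) →* ℂˣ) (i : ZMod n) :
    dihedralIndChar ψ (r i) =
      (ψ (Multiplicative.ofAdd i) : ℂ) + (ψ (Multiplicative.ofAdd (-i)) : ℂ) := by
  have hn : (n : ℂ) ≠ 0 := Nat.cast_ne_zero.2 (NeZero.ne n)
  rw [dihedralIndChar, ← equivSum.symm.sum_comp, Fintype.sum_sum_type]
  simp only [equivSum_symm_apply, inv_r, inv_sr, r_mul_r, sr_mul_r, sr_mul_sr, rotChar,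
    neg_add_cancel_comm, sub_add_cancel_left, Finset.sum_const, Finset.card_univ, ZMod.card,
    nsmul_eq_mul]
  field_simp

theorem dihedralIndChar_sr {n : ℕ} [NeZero n] (ψ : Multiplicative (ZMod n) →* ℂˣ) (j : ZMod n) :
    dihedralIndChar ψ (sr j) = 0 := by
  rw [dihedralIndChar, ← equivSum.symm.sum_comp, Fintype.sum_sum_type]
  simp [rotChar]

/-- Complex characters of `ZMod n`, as additive characters and as homomorphisms to `ℂˣ`. -/
noncomputable def unitsCharEquiv (n : ℕ) :
    (Multiplicative (ZMod n) →* ℂˣ) ≃ AddChar (ZMod n) ℂ where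
  toFun ψ := AddChar.toMonoidHomEquiv.symm ((Units.coeHom ℂ).comp ψ)
  invFun χ := χ.toMonoidHom.toHomUnits
  left_inv ψ := by ext x; rfl
  right_inv χ := by ext x; rfl

theorem unitsCharEquiv_apply {n : ℕ} (ψ : Multiplicative (ZMod n) →* ℂˣ) (i : ZMod n) :
    unitsCharEquiv n ψ i = (ψ (Multiplicative.ofAdd i) : ℂ) := rfl

theorem injective_unitsCharEquiv_iff {n : ℕ} (ψ : Multiplicative (ZMod n) →* ℂˣ) :
    Function.Injective (unitsCharEquiv n ψ) ↔ Function.Injective ψ :=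
  Units.val_injective.of_comp_iff ψ

theorem sum_addChar_apply_of_apply_eq_one {n d : ℕ} [NeZero n] (h : d ∣ n) (i : ZMod n) :
    (∑ χ : AddChar (ZMod n) ℂ, if χ d = 1 then χ i else 0) = if d ∣ i.val then (d : ℂ) else 0 := by
  obtain ⟨e, rfl⟩ := h
  have hde : d * e ≠ 0 := NeZero.ne _
  have he : (e : ℂ) ≠ 0 := Nat.cast_ne_zero.2 (right_ne_zero_of_mul hde)
  have hd : 0 < d := Nat.pos_of_ne_zero (left_ne_zero_of_mul hde)
  have hgeom (χ : AddChar (ZMod (d * e)) ℂ) :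
      (e : ℂ) * (if χ d = 1 then χ i else 0) = ∑ t ∈ Finset.range e, χ (i - (d * t : ℕ)) := by
    have hpow (t : ℕ) : χ (i - (d * t : ℕ)) = χ i * (χ (d : ZMod (d * e)))⁻¹ ^ t := by
      rw [sub_eq_add_neg, AddChar.map_add_eq_mul, AddChar.map_neg_eq_inv, mul_comm d t,
        Nat.cast_mul, ← nsmul_eq_mul, AddChar.map_nsmul_eq_pow, inv_pow]
    have hone : (χ (d : ZMod (d * e)))⁻¹ ^ e = 1 := by
      rw [inv_pow, ← AddChar.map_nsmul_eq_pow, nsmul_eq_mul, ← Nat.cast_mul,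
        (ZMod.natCast_eq_zero_iff (e * d) (d * e)).2 (mul_comm d e).dvd,
        AddChar.map_zero_eq_one, inv_one]
    simp_rw [hpow, ← Finset.mul_sum]
    split_ifs with h1
    · simp [h1, mul_comm]
    · rw [geom_sum_eq (by simpa using h1), hone]
      simp
  apply mul_left_cancel₀ he
  rw [Finset.mul_sum]
  simp_rw [hgeom]
  rw [Finset.sum_comm]
  have hval (t : ℕ) (ht : t ∈ Finset.range e) : i - (d * t : ℕ) = 0 ↔ i.val = d * t := by
    have hlt : d * t < d * e := Nat.mul_lt_mul_of_pos_left (Finset.mem_range.1 ht) hd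
    rw [sub_eq_zero, ← (ZMod.val_injective (d * e)).eq_iff, ZMod.val_cast_of_lt hlt]
  simp_rw [AddChar.sum_apply_eq_ite, ZMod.card]
  rw [Finset.sum_congr rfl fun t ht => if_congr (hval t ht) rfl rfl]
  split_ifs with hi
  · obtain ⟨t, ht⟩ := hi
    have hte : t ∈ Finset.range e := by
      have := ZMod.val_lt i
      rw [ht] at this
      exact Finset.mem_range.2 (lt_of_mul_lt_mul_left this (Nat.zero_le d))
    simp_rw [ht, Nat.mul_right_inj hd.ne']
    rw [Finset.sum_ite_eq, if_pos hte]
    push_cast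
    ring
  · rw [mul_zero]
    exact Finset.sum_eq_zero fun t _ => if_neg fun ht => hi ⟨t, ht⟩

theorem addChar_apply_natCast {n : ℕ} (χ : AddChar (ZMod n) ℂ) (m : ℕ) :
    χ (m : ZMod n) = χ 1 ^ m := by
  rw [← AddChar.map_nsmul_eq_pow, nsmul_one]

theorem addChar_injective_iff {p q : ℕ} (hp : p.Prime) (hq : q.Prime) (hpq : p ≠ q)
    (χ : AddChar (ZMod (p * q)) ℂ) :
    Function.Injective χ ↔ χ (p : ZMod (p * q)) ≠ 1 ∧ χ (q : ZMod (p * q)) ≠ 1 := by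
  have : NeZero (p * q) := ⟨mul_ne_zero hp.ne_zero hq.ne_zero⟩
  constructor
  · intro hχ
    have key (m : ℕ) (hm : ¬ p * q ∣ m) : χ (m : ZMod (p * q)) ≠ 1 := by
      rw [← AddChar.map_zero_eq_one χ, hχ.ne_iff, Ne, ZMod.natCast_eq_zero_iff]
      exact hm
    refine ⟨key p fun h => ?_, key q fun h => ?_⟩
    · exact hpq ((Nat.prime_dvd_prime_iff_eq hq hp).1 (dvd_of_mul_left_dvd h)).symm
    · exact hpq ((Nat.prime_dvd_prime_iff_eq hp hq).1 (dvd_of_mul_right_dvd h))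
  · rintro ⟨h1, h2⟩
    rw [addChar_apply_natCast, Ne, ← orderOf_dvd_iff_pow_eq_one] at h1 h2
    have hdvd : orderOf (χ 1) ∣ p * q := by
      rw [orderOf_dvd_iff_pow_eq_one, ← addChar_apply_natCast, ZMod.natCast_self,
        AddChar.map_zero_eq_one]
    have hpo : p ∣ orderOf (χ 1) := by
      by_contra h
      exact h2 (((hp.coprime_iff_not_dvd.2 h).symm).dvd_of_dvd_mul_left hdvd)
    have hqo : q ∣ orderOf (χ 1) := by
      by_contra h
      exact h1 (((hq.coprime_iff_not_dvd.2 h).symm).dvd_of_dvd_mul_right hdvd)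
    have hpqo : p * q ∣ orderOf (χ 1) :=
      ((Nat.coprime_primes hp hq).2 hpq).mul_dvd_of_dvd_of_dvd hpo hqo
    refine (injective_iff_map_eq_one χ.toMonoidHom).2 fun i hi => ?_
    obtain ⟨m, hm⟩ := ZMod.natCast_zmod_surjective (Multiplicative.toAdd i)
    change χ (Multiplicative.toAdd i) = 1 at hi
    rw [← hm, addChar_apply_natCast, ← orderOf_dvd_iff_pow_eq_one] at hi
    rw [← toAdd_eq_zero, ← hm, ZMod.natCast_eq_zero_iff]
    exact hpqo.trans hi

/-- The values of the Ramanujan sum modulo `p * q`. -/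
theorem sum_injective_addChar_apply {p q : ℕ} [NeZero (p * q)] (hp : p.Prime) (hq : q.Prime)
    (hpq : p ≠ q) (i : ZMod (p * q)) [DecidablePred fun χ : AddChar (ZMod (p * q)) ℂ =>
      Function.Injective χ] :
    (∑ χ : AddChar (ZMod (p * q)) ℂ, if Function.Injective χ then χ i else 0) =
      1 - (if p ∣ i.val then (p : ℂ) else 0) - (if q ∣ i.val then (q : ℂ) else 0)
        + (if p * q ∣ i.val then ((p * q : ℕ) : ℂ) else 0) := by
  have hone := sum_addChar_apply_of_apply_eq_one (one_dvd (p * q)) i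
  rw [if_pos (one_dvd _), Nat.cast_one, Nat.cast_one] at hone
  rw [← hone, ← sum_addChar_apply_of_apply_eq_one (dvd_mul_right p q),
    ← sum_addChar_apply_of_apply_eq_one (dvd_mul_left q p),
    ← sum_addChar_apply_of_apply_eq_one (dvd_refl (p * q)), ← Finset.sum_sub_distrib,
    ← Finset.sum_sub_distrib, ← Finset.sum_add_distrib]
  refine Finset.sum_congr rfl fun χ _ => ?_
  have h1 : χ 1 = 1 ↔ χ (p : ZMod (p * q)) = 1 ∧ χ (q : ZMod (p * q)) = 1 := by
    simp_rw [addChar_apply_natCast χ]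
    refine ⟨fun h => by simp [h], fun ⟨h, h'⟩ => ?_⟩
    have := pow_gcd_eq_one.2 ⟨h, h'⟩
    rwa [(Nat.coprime_primes hp hq).2 hpq, pow_one] at this
  have h2 : χ ((p * q : ℕ) : ZMod (p * q)) = 1 := by
    rw [ZMod.natCast_self, AddChar.map_zero_eq_one]
  simp only [addChar_injective_iff hp hq hpq, h1, h2, if_true]
  by_cases ha : χ (p : ZMod (p * q)) = 1 <;> by_cases hb : χ (q : ZMod (p * q)) = 1 <;>
    simp [ha, hb]

theorem finsum_injective_dihedralIndChar_r {p q : ℕ} [NeZero (p * q)] (hp : p.Prime) (hq : q.Prime)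
    (hpq : p ≠ q) (i : ZMod (p * q)) :
    (∑ᶠ ψ ∈ {ψ : Multiplicative (ZMod (p * q)) →* ℂˣ | Function.Injective ψ},
      dihedralIndChar ψ (r i)) =
      2 * (1 - (if p ∣ i.val then (p : ℂ) else 0) - (if q ∣ i.val then (q : ℂ) else 0)
        + (if p * q ∣ i.val then ((p * q : ℕ) : ℂ) else 0)) := by
  classical
  have hneg (d : ℕ) (hd : d ∣ p * q) : d ∣ (-i).val ↔ d ∣ i.val := by
    rw [ZMod.neg_val]
    split_ifs with h
    · simp [h]
    · exact Nat.dvd_sub_iff_right (ZMod.val_lt i).le hd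
  rw [← finsum_comp_equiv (unitsCharEquiv (p * q)).symm, finsum_eq_sum_of_fintype]
  have hterm (χ : AddChar (ZMod (p * q)) ℂ) :
      (∑ᶠ (_ : (unitsCharEquiv (p * q)).symm χ ∈
        {ψ : Multiplicative (ZMod (p * q)) →* ℂˣ | Function.Injective ψ}),
        dihedralIndChar ((unitsCharEquiv (p * q)).symm χ) (r i)) =
      (if Function.Injective χ then χ i else 0) + (if Function.Injective χ then χ (-i) else 0) := by
    simp only [Set.mem_ofPred_eq, ← injective_unitsCharEquiv_iff, Equiv.apply_symm_apply]
    rw [finsum_eq_if, dihedralIndChar_r,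
      ← unitsCharEquiv_apply, ← unitsCharEquiv_apply, Equiv.apply_symm_apply]
    split_ifs <;> simp
  simp_rw [hterm]
  rw [Finset.sum_add_distrib, sum_injective_addChar_apply hp hq hpq,
    sum_injective_addChar_apply hp hq hpq]
  simp only [hneg p (dvd_mul_right p q), hneg q (dvd_mul_left q p), hneg _ dvd_rfl]
  ring

/-- Let `p ≠ q` be odd primes and `G = D_{2pq}` the dihedral group of order
`2pq` with rotation subgroup `C_{pq}` and a fixed reflection `s = sr k`.  Write `C₂ = ⟨s⟩`,
`D_{2p} = ⟨r^q, s⟩` and `D_{2q} = ⟨r^p, s⟩`.  Then for every `g ∈ G`,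
`Σ_ψ (Ind_{C_{pq}}^G ψ)(g) + 2·π_{D_{2p}}(g) + 2·π_{D_{2q}}(g) = 2 + 2·π_{C₂}(g)`,
the sum running over all faithful one-dimensional characters `ψ` of `C_{pq}`. -/
theorem dihedral_faithful_induced_character_identity
    (p q : ℕ) (hp : p.Prime) (hq : q.Prime) (hpodd : Odd p) (hqodd : Odd q) (hpq : p ≠ q)
    [NeZero (p * q)] (k : ZMod (p * q)) :
    ∀ g : DihedralGroup (p * q),
      (∑ᶠ ψ ∈ {ψ : Multiplicative (ZMod (p * q)) →* ℂˣ | Function.Injective ψ},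
          dihedralIndChar ψ g)
        + 2 * permChar (Subgroup.closure {DihedralGroup.r (q : ZMod (p * q)),
            DihedralGroup.sr k}) g
        + 2 * permChar (Subgroup.closure {DihedralGroup.r (p : ZMod (p * q)),
            DihedralGroup.sr k}) g
      = 2 + 2 * permChar (Subgroup.zpowers (DihedralGroup.sr k)) g := by
  have hzp : Subgroup.zpowers (sr k) =
      Subgroup.closure {r ((p * q : ℕ) : ZMod (p * q)), sr k} := by
    rw [ZMod.natCast_self, r_zero, Subgroup.closure_insert_one, Subgroup.zpowers_eq_closure]
  rw [hzp]
  rintro (i | j)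
  · rw [finsum_injective_dihedralIndChar_r hp hq hpq, permChar_closure_r (dvd_mul_right p q),
      permChar_closure_r (dvd_mul_left q p), permChar_closure_r dvd_rfl]
    ring
  · rw [permChar_closure_sr (dvd_mul_right p q) hpodd, permChar_closure_sr (dvd_mul_left q p) hqodd,
      permChar_closure_sr dvd_rfl (hpodd.mul hqodd)]
    simp only [dihedralIndChar_sr, finsum_zero]
    ring
end
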